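/- Under the uncoupled affine Gaussian path x_t = α_t x_1 + σ_t x_0, x_0 ~ N(0,I) independent of x_1, with Z_t(x_t) = E_{x_1 ~ p(x_1|x_t)}[e^{-J(x_1)}] > 0, the guidance field g_t(x_t) = E_{x_1 ~ p(x_1|x_t)}[(e^{-J(x_1)}/Z_t(x_t) − 1) v(x_t|x_1)] equals (b_t σ_t^2/α_t) ∇_{x_t} log Z_t(x_t), where b_t = (α̇_t σ_t − σ̇_t α_t)/σ_t and v(x_t|x_1) = (σ̇_t/σ_t) x_t + b_t x_1. -/

import Mathlib

open MeasureTheory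

open scoped InnerProductSpace Gradient

/-- A density with exponential moments of all orders in `X` may be differentiated under the
integral sign along its exponential tilts by `X`. -/
theorem integrable_and_hasDerivAt_integral_exp_tilt {Ω : Type*} [MeasurableSpace Ω]
    {μ : Measure Ω} {X f : Ω → ℝ} (hf : ∀ x, 0 ≤ f x)
    (hint : ∀ t : ℝ, Integrable (fun x => f x * Real.exp (t * X x)) μ) :
    Integrable (fun x => f x * X x) μ ∧
      HasDerivAt (fun t : ℝ => ∫ x, f x * Real.exp (t * X x) ∂μ) (∫ x, f x * X x ∂μ) 0 := by
  have hfm : AEMeasurable (fun x => ENNReal.ofReal (f x)) μ := by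
    have h0 := (hint 0).aestronglyMeasurable.aemeasurable
    simp only [zero_mul, Real.exp_zero, mul_one] at h0
    exact h0.ennreal_ofReal
  have hlt : ∀ᵐ x ∂μ, ENNReal.ofReal (f x) < ⊤ := .of_forall fun _ => ENNReal.ofReal_lt_top
  have hset : ProbabilityTheory.integrableExpSet X
      (μ.withDensity fun x => ENNReal.ofReal (f x)) = Set.univ := by
    refine Set.eq_univ_of_forall fun t => ?_
    change Integrable _ _
    rw [integrable_withDensity_iff_integrable_smul₀' hfm hlt]
    simpa only [ENNReal.toReal_ofReal (hf _), smul_eq_mul] using hint t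
  have h0 : (0 : ℝ) ∈ interior (ProbabilityTheory.integrableExpSet X
      (μ.withDensity fun x => ENNReal.ofReal (f x))) := by simp [hset]
  constructor
  · have h := ProbabilityTheory.integrable_of_mem_interior_integrableExpSet h0
    rw [integrable_withDensity_iff_integrable_smul₀' hfm hlt] at h
    simpa only [ENNReal.toReal_ofReal (hf _), smul_eq_mul] using h
  · have h := ProbabilityTheory.hasDerivAt_mgf h0
    unfold ProbabilityTheory.mgf at h
    simp only [integral_withDensity_eq_integral_toReal_smul₀ hfm hlt,
      ENNReal.toReal_ofReal (hf _), smul_eq_mul, zero_mul, Real.exp_zero, mul_one] at h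
    exact h

/-- The conditional score `∇_y log N(y; α x, σ² I)`. -/
noncomputable def gaussianScore {d : ℕ} (α σ : ℝ) (y x : EuclideanSpace ℝ (Fin d)) :
    EuclideanSpace ℝ (Fin d) :=
  (σ ^ 2)⁻¹ • (α • x - y)

section Score

variable {d : ℕ} {α σ : ℝ}

theorem exp_neg_norm_sq_shift (hσ : σ ≠ 0) (y x e : EuclideanSpace ℝ (Fin d)) (t : ℝ) :
    Real.exp (-‖y + t • e - α • x‖ ^ 2 / (2 * σ ^ 2)) =
      Real.exp (-(t ^ 2 * ‖e‖ ^ 2) / (2 * σ ^ 2)) *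
        (Real.exp (-‖y - α • x‖ ^ 2 / (2 * σ ^ 2)) *
          Real.exp (t * ⟪gaussianScore α σ y x, e⟫_ℝ)) := by
  have h : ‖y + t • e - α • x‖ ^ 2 =
      ‖y - α • x‖ ^ 2 + 2 * (t * ⟪y - α • x, e⟫_ℝ) + t ^ 2 * ‖e‖ ^ 2 := by
    rw [show y + t • e - α • x = (y - α • x) + t • e by abel, norm_add_sq_real,
      inner_smul_right, norm_smul, mul_pow, Real.norm_eq_abs, sq_abs]
  have h' : ⟪gaussianScore α σ y x, e⟫_ℝ = -((σ ^ 2)⁻¹ * ⟪y - α • x, e⟫_ℝ) := by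
    rw [gaussianScore, real_inner_smul_left, ← neg_sub y, inner_neg_left, mul_neg]
  rw [← Real.exp_add, ← Real.exp_add, h, h']
  congr 1
  field_simp
  ring

theorem hasGradientAt_exp_neg_norm_sq (y x : EuclideanSpace ℝ (Fin d)) :
    HasGradientAt (fun y => Real.exp (-‖y - α • x‖ ^ 2 / (2 * σ ^ 2)))
      (Real.exp (-‖y - α • x‖ ^ 2 / (2 * σ ^ 2)) • gaussianScore α σ y x) y := by
  rw [hasGradientAt_iff_hasFDerivAt]
  have h := ((((hasFDerivAt_id (𝕜 := ℝ) y).sub_const (α • x)).norm_sq.neg).mul_const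
    ((2 * σ ^ 2)⁻¹)).exp
  refine (h.congr_fderiv ?_)
  ext e
  have h' : ⟪gaussianScore α σ y x, e⟫_ℝ = -((σ ^ 2)⁻¹ * ⟪y - α • x, e⟫_ℝ) := by
    rw [gaussianScore, real_inner_smul_left, ← neg_sub y, inner_neg_left, mul_neg]
  simp [real_inner_smul_left, h', inner_sub_left, div_eq_mul_inv]
  ring

/-- The gradient of a Gaussian mixture is the integral of the gradients of its components. -/
theorem integrable_and_gradient_gaussian_mixture (hσ : σ ≠ 0)
    {q pm : EuclideanSpace ℝ (Fin d) → ℝ} (hq : ∀ x, 0 ≤ q x)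
    (hpm : ∀ y, pm y = ∫ x, Real.exp (-‖y - α • x‖ ^ 2 / (2 * σ ^ 2)) * q x)
    (hint : ∀ y, Integrable fun x => Real.exp (-‖y - α • x‖ ^ 2 / (2 * σ ^ 2)) * q x)
    {y : EuclideanSpace ℝ (Fin d)} (hdiff : DifferentiableAt ℝ pm y) :
    Integrable (fun x =>
        (Real.exp (-‖y - α • x‖ ^ 2 / (2 * σ ^ 2)) * q x) • gaussianScore α σ y x) ∧
      ∇ pm y = ∫ x, (Real.exp (-‖y - α • x‖ ^ 2 / (2 * σ ^ 2)) * q x) •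
        gaussianScore α σ y x := by
  set f : EuclideanSpace ℝ (Fin d) → ℝ :=
    fun x => Real.exp (-‖y - α • x‖ ^ 2 / (2 * σ ^ 2)) * q x with hf
  have hf0 : ∀ x, 0 ≤ f x := fun x => mul_nonneg (Real.exp_pos _).le (hq x)
  have hshift : ∀ (e x : EuclideanSpace ℝ (Fin d)) (t : ℝ),
      Real.exp (-‖y + t • e - α • x‖ ^ 2 / (2 * σ ^ 2)) * q x =
        Real.exp (-(t ^ 2 * ‖e‖ ^ 2) / (2 * σ ^ 2)) *
          (f x * Real.exp (t * ⟪gaussianScore α σ y x, e⟫_ℝ)) := fun e x t => by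
    rw [exp_neg_norm_sq_shift hσ, hf]
    ring
  have htilt : ∀ e, Integrable (fun x => f x * ⟪gaussianScore α σ y x, e⟫_ℝ) ∧
      HasDerivAt (fun t : ℝ => ∫ x, f x * Real.exp (t * ⟪gaussianScore α σ y x, e⟫_ℝ))
        (∫ x, f x * ⟪gaussianScore α σ y x, e⟫_ℝ) 0 := fun e => by
    refine integrable_and_hasDerivAt_integral_exp_tilt hf0 fun t => ?_
    have h := hint (y + t • e)
    simp only [hshift] at h
    exact (integrable_const_mul_iff (Real.exp_ne_zero _).isUnit _).1 h
  have hI : Integrable (fun x => f x • gaussianScore α σ y x) := by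
    refine Integrable.of_eval_piLp fun i => ?_
    refine (htilt (EuclideanSpace.single i 1)).1.congr (.of_forall fun x => ?_)
    simp [EuclideanSpace.inner_single_right]
  refine ⟨hI, ext_inner_right ℝ fun e => ?_⟩
  have hline : HasDerivAt (fun t : ℝ => pm (y + t • e)) ⟪∇ pm y, e⟫_ℝ 0 := by
    rw [inner_gradient_left]
    exact hdiff.hasFDerivAt.hasLineDerivAt e
  have hgauss : HasDerivAt (fun t : ℝ => Real.exp (-(t ^ 2 * ‖e‖ ^ 2) / (2 * σ ^ 2))) 0 0 := by
    have h := ((((hasDerivAt_id (0 : ℝ)).pow 2).mul_const (‖e‖ ^ 2)).neg.div_const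
      (2 * σ ^ 2)).exp
    simpa using h
  have hprod := hgauss.mul (htilt e).2
  have heq : (fun t : ℝ => pm (y + t • e)) =
      (fun t : ℝ => Real.exp (-(t ^ 2 * ‖e‖ ^ 2) / (2 * σ ^ 2))) *
        fun t : ℝ => ∫ x, f x * Real.exp (t * ⟪gaussianScore α σ y x, e⟫_ℝ) := by
    funext t
    simp only [hpm, hshift, integral_const_mul, Pi.mul_apply]
  rw [heq] at hline
  rw [hline.unique hprod, real_inner_comm, ← integral_inner hI]
  simp [real_inner_smul_right, real_inner_comm]

end Score

/-- The gradient of a quotient in logarithmic form. -/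
theorem HasGradientAt.div_of_score {F : Type*} [NormedAddCommGroup F] [InnerProductSpace ℝ F]
    [CompleteSpace F] {u v : F → ℝ} {s v' y : F} (hu : HasGradientAt u (u y • s) y)
    (hv : HasGradientAt v v' y) (hy : v y ≠ 0) :
    HasGradientAt (fun y => u y / v y) ((u y / v y) • (s - (v y)⁻¹ • v')) y := by
  rw [hasGradientAt_iff_hasFDerivAt] at *
  simp only [div_eq_mul_inv]
  refine (hu.fun_mul ((hasDerivAt_inv hy).comp_hasFDerivAt y hv)).congr_fderiv ?_
  ext e
  simp
  field_simp
  ring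

theorem HasGradientAt.real_log {F : Type*} [NormedAddCommGroup F] [InnerProductSpace ℝ F]
    [CompleteSpace F] {u : F → ℝ} {u' y : F} (hu : HasGradientAt u u' y) (hy : u y ≠ 0) :
    HasGradientAt (fun y => Real.log (u y)) ((u y)⁻¹ • u') y := by
  rw [hasGradientAt_iff_hasFDerivAt] at *
  refine (hu.log hy).congr_fderiv ?_
  ext e
  simp

/-- Under the uncoupled affine Gaussian path `x_t = α_t x₁ + σ_t x₀`, `x₀ ~ N(0,I)`
independent of `x₁ ~ p(x₁)`, the guidance vector field
`g_t(x_t) = E_{x₁~p(x₁|x_t)}[(e^{-J(x₁)}/Z_t(x_t) − 1) v(x_t|x₁)]`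
equals `(b_t σ_t²/α_t) ∇_{x_t} log Z_t(x_t)`, where
`b_t = (α̇_t σ_t − σ̇_t α_t)/σ_t` and `v(x_t|x₁) = (σ̇_t/σ_t) x_t + b_t x₁`. -/
theorem guidance_eq_grad_logZ_gaussian {d : ℕ}
    (α σ α' σ' : ℝ) (hσ : 0 < σ) (hα : α ≠ 0)
    (p1 : EuclideanSpace ℝ (Fin d) → ℝ)               -- density of x₁
    (hp1 : ∀ x, 0 ≤ p1 x)
    (J : EuclideanSpace ℝ (Fin d) → ℝ)
    (k : EuclideanSpace ℝ (Fin d) → EuclideanSpace ℝ (Fin d) → ℝ)  -- p(x_t|x₁)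
    (hk : ∀ xt x1, k xt x1 = (2 * Real.pi * σ ^ 2) ^ (-(d : ℝ) / 2)
        * Real.exp (-‖xt - α • x1‖ ^ 2 / (2 * σ ^ 2)))
    (pm : EuclideanSpace ℝ (Fin d) → ℝ)               -- marginal p(x_t)
    (hpm : ∀ xt, pm xt = ∫ x1, k xt x1 * p1 x1)
    (hpm_pos : ∀ xt, 0 < pm xt)
    (post : EuclideanSpace ℝ (Fin d) → EuclideanSpace ℝ (Fin d) → ℝ)  -- p(x₁|x_t)
    (hpost : ∀ xt x1, post xt x1 = k xt x1 * p1 x1 / pm xt)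
    (Zt : EuclideanSpace ℝ (Fin d) → ℝ)
    (hZt : ∀ xt, Zt xt = ∫ x1, Real.exp (-(J x1)) * post xt x1)
    (hZpos : ∀ xt, 0 < Zt xt)
    (hZdiff : Differentiable ℝ Zt)
    (b : ℝ) (hb : b = (α' * σ - σ' * α) / σ)
    (g : EuclideanSpace ℝ (Fin d) → EuclideanSpace ℝ (Fin d))
    (hg : ∀ xt, g xt = ∫ x1, ((Real.exp (-(J x1)) / Zt xt - 1) * post xt x1)
        • ((σ' / σ) • xt + b • x1))
    -- integrability of the relevant conditional moments
    (hint0 : ∀ xt, Integrable (fun x1 => Real.exp (-(J x1)) * post xt x1))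
    (hint1 : ∀ xt, Integrable (fun x1 =>
        ((Real.exp (-(J x1)) / Zt xt - 1) * post xt x1) • ((σ' / σ) • xt + b • x1)))
    -- differentiation under the integral sign
    (hswap : ∀ xt, gradient Zt xt
        = ∫ x1, Real.exp (-(J x1)) • gradient (fun y => post y x1) xt)
    (hpostdiff : ∀ x1, Differentiable ℝ (fun y => post y x1))
    (xt : EuclideanSpace ℝ (Fin d)) :
    g xt = (b * σ ^ 2 / α) • gradient (fun y => Real.log (Zt y)) xt := by
  set C : ℝ := (2 * Real.pi * σ ^ 2) ^ (-(d : ℝ) / 2) with hC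
  have hCpos : 0 < C := by positivity
  have hintk : ∀ y, Integrable fun x => k y x * p1 x := fun y => by
    by_contra h
    have := hpm_pos y
    rw [hpm, integral_undef h] at this
    exact this.false
  have hkq : ∀ y x, k y x * p1 x =
      Real.exp (-‖y - α • x‖ ^ 2 / (2 * σ ^ 2)) * (C * p1 x) := fun y x => by
    rw [hk]
    ring
  have hkgrad : ∀ x, HasGradientAt (fun y => k y x * p1 x)
      ((k xt x * p1 x) • gaussianScore α σ xt x) xt := fun x => by
    have h := hasGradientAt_exp_neg_norm_sq (α := α) (σ := σ) xt x
    rw [hasGradientAt_iff_hasFDerivAt] at *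
    simp only [hkq]
    refine (h.mul_const (C * p1 x)).congr_fderiv ?_
    ext e
    simp
    ring
  -- the marginal is the quotient of two differentiable functions wherever `p1` is positive
  obtain ⟨x₀, hx₀⟩ : ∃ x, p1 x ≠ 0 := by
    by_contra! h
    have := hpm_pos xt
    simp [hpm, h] at this
  have hne : ∀ y, k y x₀ * p1 x₀ ≠ 0 := fun y => by
    rw [hkq]
    exact mul_ne_zero (Real.exp_ne_zero _) (mul_ne_zero hCpos.ne' hx₀)
  have hpmdiff : DifferentiableAt ℝ pm xt := by
    have heq : pm = fun y => (k y x₀ * p1 x₀) * (post y x₀)⁻¹ := by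
      funext y
      rw [hpost, ← div_eq_mul_inv, div_div_cancel₀ (hne y)]
    rw [heq]
    refine (hkgrad x₀).differentiableAt.fun_mul ((hpostdiff x₀ xt).fun_inv ?_)
    rw [hpost]
    exact div_ne_zero (hne xt) (hpm_pos xt).ne'
  obtain ⟨hIs, hgrads⟩ := integrable_and_gradient_gaussian_mixture (α := α) hσ.ne'
    (q := fun x => C * p1 x) (fun x => mul_nonneg hCpos.le (hp1 x))
    (fun y => by simp only [hpm, hkq]) (fun y => by simpa only [hkq] using hintk y) hpmdiff
  simp only [← hkq] at hIs hgrads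
  -- the posterior score has mean zero
  set s : EuclideanSpace ℝ (Fin d) := (pm xt)⁻¹ • ∇ pm xt with hs
  set T : EuclideanSpace ℝ (Fin d) → EuclideanSpace ℝ (Fin d) :=
    fun x => gaussianScore α σ xt x - s with hT
  have hpostgrad : ∀ x, ∇ (fun y => post y x) xt = post xt x • T x := fun x => by
    simp only [hpost]
    exact ((hkgrad x).div_of_score hpmdiff.hasGradientAt (hpm_pos xt).ne').gradient
  have hIpost : Integrable (fun x => post xt x) := by
    simp only [hpost]
    exact (hintk xt).div_const _
  have hpost1 : ∫ x, post xt x = 1 := by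
    simp only [hpost]
    rw [integral_div, ← hpm, div_self (hpm_pos xt).ne']
  have hpostS : ∀ x, post xt x • gaussianScore α σ xt x =
      (pm xt)⁻¹ • ((k xt x * p1 x) • gaussianScore α σ xt x) := fun x => by
    rw [hpost, smul_smul, div_eq_inv_mul]
  have hIpostS : Integrable (fun x => post xt x • gaussianScore α σ xt x) := by
    simp only [hpostS]
    exact hIs.fun_smul _
  have hIpostT : Integrable (fun x => post xt x • T x) := by
    simp only [hT, smul_sub]
    exact hIpostS.sub (hIpost.smul_const s)
  have hpostT : ∫ x, post xt x • T x = 0 := by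
    simp only [hT, smul_sub]
    rw [integral_sub hIpostS (hIpost.smul_const s), integral_smul_const, hpost1, one_smul]
    simp only [hpostS]
    rw [integral_smul, ← hgrads, hs, sub_self]
  -- the guidance weight has mean zero
  set w : EuclideanSpace ℝ (Fin d) → ℝ :=
    fun x => (Real.exp (-(J x)) / Zt xt - 1) * post xt x with hw
  have hweq : ∀ x, w x = (Zt xt)⁻¹ * (Real.exp (-(J x)) * post xt x) - post xt x := fun x => by
    simp only [hw]
    ring
  have hIw : Integrable w := by
    rw [funext hweq]
    exact ((hint0 xt).const_mul _).sub hIpost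
  have hw0 : ∫ x, w x = 0 := by
    rw [funext hweq, integral_sub ((hint0 xt).const_mul _) hIpost, integral_const_mul, ← hZt,
      hpost1, inv_mul_cancel₀ (hZpos xt).ne', sub_self]
  rw [((hZdiff xt).hasGradientAt.real_log (hZpos xt).ne').gradient, hg]
  change ∫ x, w x • ((σ' / σ) • xt + b • x) = _
  rcases eq_or_ne b 0 with hb0 | hb0
  · simp only [hb0, zero_smul, add_zero, zero_mul, zero_div]
    rw [integral_smul_const, hw0, zero_smul]
  set c : EuclideanSpace ℝ (Fin d) :=
    (σ' / σ) • xt + (b * σ ^ 2 / α) • s + (b / α) • xt with hc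
  have hβ : b * σ ^ 2 / α ≠ 0 := by positivity
  have hsplit : ∀ x, w x • ((σ' / σ) • xt + b • x) =
      w x • c + (b * σ ^ 2 / α) • (w x • T x) := fun x => by
    have hx : (b * σ ^ 2 / α) • gaussianScore α σ xt x = b • x - (b / α) • xt := by
      rw [gaussianScore, smul_smul, smul_sub, smul_smul]
      congr 2 <;> field_simp
    rw [smul_comm _ (w x), ← smul_add, hT, smul_sub, hx, hc]
    congr 1
    abel
  have hIwT : Integrable (fun x => w x • T x) := by
    have h := (hint1 xt).sub (hIw.smul_const c)
    have h' : (fun x => w x • ((σ' / σ) • xt + b • x)) - (fun x => w x • c) =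
        fun x => (b * σ ^ 2 / α) • (w x • T x) := by
      funext x
      rw [Pi.sub_apply, hsplit, add_sub_cancel_left]
    have h2 : Integrable (fun x => (b * σ ^ 2 / α) • (w x • T x)) := by
      rw [← h']
      exact h
    exact (integrable_smul_iff hβ _).1 h2
  have hZgrad : (Zt xt)⁻¹ • ∇ Zt xt = ∫ x, w x • T x := by
    rw [hswap, ← integral_smul, ← add_zero (∫ x, w x • T x), ← hpostT,
      ← integral_add hIwT hIpostT]
    refine integral_congr_ae (.of_forall fun x => ?_)
    simp only [hpostgrad, hweq, smul_smul, ← add_smul]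
    congr 1
    ring
  simp only [hsplit]
  rw [integral_add (hIw.smul_const c) (hIwT.fun_smul _), integral_smul_const, hw0, zero_smul,
    zero_add, integral_smul, hZgrad]
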